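/- arXiv:1310.6511 — 4 statements merged into one kernel-verified Lean document; each statement's English description precedes it below -/
import Mathlib

section
/- Let α > 2, s > 0 and r0 > 0. Then the improper integral 2·∫_{r0}^{∞} (1 − exp(−s·r^{−α}))·r dr converges, the integral ∫_0^{s·r0^{−α}} y^{−2/α} e^{−y} dy converges, and 2·∫_{r0}^{∞} (1 − exp(−s·r^{−α}))·r dr = (exp(−s·r0^{−α}) − 1)·r0² + s^{2/α}·∫_0^{s·r0^{−α}} y^{−2/α} e^{−y} dy. -/
open MeasureTheory Real

theorem intervalIntegrable_rpow_mul_exp_neg {p : ℝ} (hp : -1 < p) (a b : ℝ) :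
    IntervalIntegrable (fun y : ℝ => y ^ p * Real.exp (-y)) volume a b :=
  (intervalIntegral.intervalIntegrable_rpow' hp).mul_continuousOn (by fun_prop)

theorem hasDerivAt_integral_rpow_mul_exp_neg {p t : ℝ} (hp : -1 < p) (ht : 0 < t) :
    HasDerivAt (fun t : ℝ => ∫ y in (0 : ℝ)..t, y ^ p * Real.exp (-y))
      (t ^ p * Real.exp (-t)) t := by
  refine intervalIntegral.integral_hasDerivAt_right
    (intervalIntegrable_rpow_mul_exp_neg hp 0 t) ?_ ?_
  · exact (Measurable.stronglyMeasurable (by fun_prop)).stronglyMeasurableAtFilter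
  · exact (continuousAt_id.rpow_const (Or.inl ht.ne')).mul (by fun_prop)

/-- The antiderivative of `2 (1 - exp (-s r ^ (-α))) r` that integration by parts and the
substitution `y = s r ^ (-α)` produce. -/
theorem hasDerivAt_interference_primitive {α s r : ℝ} (hα : 2 < α) (hs : 0 < s) (hr : 0 < r) :
    HasDerivAt (fun r : ℝ => (1 - Real.exp (-(s * r ^ (-α)))) * r ^ 2
        - s ^ (2 / α) * ∫ y in (0 : ℝ)..(s * r ^ (-α)), y ^ (-(2 / α)) * Real.exp (-y))
      (2 * ((1 - Real.exp (-(s * r ^ (-α)))) * r)) r := by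
  have hα0 : 0 < α := by linarith
  have hp : -1 < -(2 / α) := by
    have : 2 / α < 1 := (div_lt_one hα0).2 hα
    linarith
  have hu : HasDerivAt (fun r : ℝ => s * r ^ (-α)) (s * (-α * r ^ (-α - 1))) r :=
    (Real.hasDerivAt_rpow_const (Or.inl hr.ne')).const_mul s
  have hΦ := (hasDerivAt_integral_rpow_mul_exp_neg hp
    (mul_pos hs (Real.rpow_pos_of_pos hr (-α)))).comp r hu
  have hG := ((hu.neg.exp.const_sub 1).mul (hasDerivAt_pow 2 r)).sub (hΦ.const_mul (s ^ (2 / α)))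
  have hcancel : s ^ (2 / α) * (s * r ^ (-α)) ^ (-(2 / α)) = r ^ 2 := by
    rw [Real.mul_rpow hs.le (Real.rpow_nonneg hr.le _), ← mul_assoc, ← Real.rpow_add hs,
      ← Real.rpow_mul hr.le, add_neg_cancel, Real.rpow_zero, one_mul, ← Real.rpow_natCast]
    congr 1
    push_cast
    field_simp
  refine hG.congr_deriv ?_
  push_cast
  linear_combination (-(Real.exp (-(s * r ^ (-α))) * (s * (-α * r ^ (-α - 1))))) * hcancel

open Filter Topology in
theorem tendsto_interference_primitive {α s : ℝ} (hα : 2 < α) (hs : 0 < s) :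
    Tendsto (fun r : ℝ => (1 - Real.exp (-(s * r ^ (-α)))) * r ^ 2
        - s ^ (2 / α) * ∫ y in (0 : ℝ)..(s * r ^ (-α)), y ^ (-(2 / α)) * Real.exp (-y))
      atTop (𝓝 0) := by
  have hα0 : 0 < α := by linarith
  have hp : -1 < -(2 / α) := by
    have : 2 / α < 1 := (div_lt_one hα0).2 hα
    linarith
  have hu : Tendsto (fun r : ℝ => s * r ^ (-α)) atTop (𝓝 0) := by
    simpa using (tendsto_rpow_neg_atTop hα0).const_mul s
  have hΦ := ((intervalIntegral.continuous_primitive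
    (intervalIntegrable_rpow_mul_exp_neg hp) 0).tendsto 0).comp hu
  have hbound : Tendsto (fun r : ℝ => s * r ^ (-(α - 2))) atTop (𝓝 0) := by
    simpa using (tendsto_rpow_neg_atTop (sub_pos.2 hα)).const_mul s
  have hfst : Tendsto (fun r : ℝ => (1 - Real.exp (-(s * r ^ (-α)))) * r ^ 2) atTop (𝓝 0) := by
    refine tendsto_of_tendsto_of_tendsto_of_le_of_le' tendsto_const_nhds hbound ?_ ?_
    · filter_upwards [eventually_gt_atTop 0] with r hr
      have : Real.exp (-(s * r ^ (-α))) ≤ 1 := Real.exp_le_one_iff.2 (by simp; positivity)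
      exact mul_nonneg (by linarith) (by positivity)
    · filter_upwards [eventually_gt_atTop 0] with r hr
      have hr2 : r ^ (-(α - 2)) = r ^ (-α) * r ^ 2 := by
        rw [← Real.rpow_natCast, ← Real.rpow_add hr]
        congr 1
        push_cast
        ring
      rw [hr2, ← mul_assoc]
      gcongr
      linarith [Real.add_one_le_exp (-(s * r ^ (-α)))]
  simpa using hfst.sub (hΦ.const_mul (s ^ (2 / α)))

/-- Key integral identity in the Laplace transform of the Poisson interference:
`2∫_{r0}^∞ (1 - e^{-s r^{-α}}) r dr = (e^{-s r0^{-α}} - 1) r0² + s^{2/α} γ(1 - 2/α, s r0^{-α})`,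
together with the convergence of both integrals. -/
theorem interference_laplace_integral_identity
    (α s r0 : ℝ) (hα : 2 < α) (hs : 0 < s) (hr0 : 0 < r0) :
    IntegrableOn (fun r : ℝ => (1 - Real.exp (-(s * r ^ (-α)))) * r) (Set.Ici r0) ∧
    IntervalIntegrable (fun y : ℝ => y ^ (-(2 / α)) * Real.exp (-y))
      volume 0 (s * r0 ^ (-α)) ∧
    2 * ∫ r in Set.Ici r0, (1 - Real.exp (-(s * r ^ (-α)))) * r
      = (Real.exp (-(s * r0 ^ (-α))) - 1) * r0 ^ 2
        + s ^ (2 / α) * ∫ y in (0 : ℝ)..(s * r0 ^ (-α)), y ^ (-(2 / α)) * Real.exp (-y) := by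
  have hpos : ∀ r ∈ Set.Ioi r0, 0 ≤ 2 * ((1 - Real.exp (-(s * r ^ (-α)))) * r) := by
    intro r hr
    have hr' : 0 < r := hr0.trans hr
    have : Real.exp (-(s * r ^ (-α))) ≤ 1 := Real.exp_le_one_iff.2 (by simp; positivity)
    have : 0 ≤ 1 - Real.exp (-(s * r ^ (-α))) := by linarith
    positivity
  have hderiv := fun r (hr : r ∈ Set.Ici r0) =>
    hasDerivAt_interference_primitive hα hs (hr0.trans_le hr)
  have hlim := tendsto_interference_primitive hα hs
  refine ⟨?_, intervalIntegrable_rpow_mul_exp_neg ?_ _ _, ?_⟩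
  · rw [integrableOn_Ici_iff_integrableOn_Ioi]
    refine ((integrableOn_Ioi_deriv_of_nonneg' hderiv hpos hlim).const_mul (1 / 2)).congr ?_
    exact Filter.Eventually.of_forall fun r => by ring
  · have : 2 / α < 1 := (div_lt_one (by linarith)).2 hα
    linarith
  · rw [integral_Ici_eq_integral_Ioi, ← integral_const_mul,
      integral_Ioi_of_hasDerivAt_of_nonneg' hderiv hpos hlim]
    ring
end

section
/- Let α > 2, s > 0 and r0 > 0. Then (exp(−s·r0^{−α}) − 1)·r0² + s^{2/α}·∫_0^{s·r0^{−α}} y^{−2/α} e^{−y} dy ≥ 0. -/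
open Real

/-- Lower bound on the lower incomplete gamma function `γ(1 - p, T)`. -/
lemma rpow_neg_mul_one_sub_exp_neg_le_integral {p T : ℝ} (hp0 : 0 ≤ p) (hp1 : p < 1)
    (hT : 0 ≤ T) :
    T ^ (-p) * (1 - Real.exp (-T)) ≤ ∫ y in (0 : ℝ)..T, y ^ (-p) * Real.exp (-y) := by
  have hexp : ∫ y in (0 : ℝ)..T, Real.exp (-y) = 1 - Real.exp (-T) := by
    simp
  rw [← hexp, ← intervalIntegral.integral_const_mul]
  refine intervalIntegral.integral_mono_on_of_le_Ioo hT
    (Continuous.intervalIntegrable (by fun_prop) _ _)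
    ((intervalIntegral.intervalIntegrable_rpow' (by linarith)).mul_continuousOn
      (by fun_prop)) fun y hy => ?_
  exact mul_le_mul_of_nonneg_right
    (Real.rpow_le_rpow_of_nonpos hy.1 hy.2.le (by linarith)) (Real.exp_pos _).le

/-- Nonnegativity of the exponent term in the closed-form interference Laplace transform:
`(e^{-s r0^{-α}} - 1) r0² + s^{2/α} γ(1 - 2/α, s r0^{-α}) ≥ 0`. -/
theorem interference_laplace_exponent_nonneg
    (α s r0 : ℝ) (hα : 2 < α) (hs : 0 < s) (hr0 : 0 < r0) :
    0 ≤ (Real.exp (-(s * r0 ^ (-α))) - 1) * r0 ^ 2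
        + s ^ (2 / α) * ∫ y in (0 : ℝ)..(s * r0 ^ (-α)), y ^ (-(2 / α)) * Real.exp (-y) := by
  have hα0 : 0 < α := by linarith
  have hbound := mul_le_mul_of_nonneg_left
    (rpow_neg_mul_one_sub_exp_neg_le_integral (p := 2 / α) (T := s * r0 ^ (-α))
      (by positivity) ((div_lt_one hα0).2 hα) (by positivity))
    (Real.rpow_nonneg hs.le (2 / α))
  have hscale : s ^ (2 / α) * (s * r0 ^ (-α)) ^ (-(2 / α)) = r0 ^ 2 := by
    rw [Real.mul_rpow hs.le (by positivity), ← mul_assoc, ← Real.rpow_add hs,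
      ← Real.rpow_mul hr0.le, add_neg_cancel, Real.rpow_zero, one_mul, neg_mul_neg,
      mul_div_cancel₀ _ hα0.ne', Real.rpow_two]
  rw [← mul_assoc, hscale] at hbound
  linarith
end

section
/- Let G0 > 0, G1 > 0, G2 > 0, G3 > 0, and let ν* ∈ (0,1) be the unique root in (0,1) of G2·x² + (G0·G1 + G3 − G2)·x − G3 = 0. Then for every ν ∈ (0,1), max( (G2 + G3/ν)/G0 , G1/(1 − ν) ) ≥ G1/(1 − ν*), with equality if and only if ν = ν*. -/
open Real

/-- Min-max characterization of the jointly optimal power-splitting ratio: for every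
`ν ∈ (0,1)`, `max((G2 + G3/ν)/G0, G1/(1-ν)) ≥ G1/(1-ν*)`, with equality iff `ν = ν*`,
where `ν*` is the unique root in `(0,1)` of `G2 x² + (G0 G1 + G3 - G2) x - G3 = 0`. -/
theorem optimal_splitting_minmax
    (G0 G1 G2 G3 νs : ℝ)
    (h0 : 0 < G0) (h1 : 0 < G1) (h2 : 0 < G2) (h3 : 0 < G3)
    (hmem : νs ∈ Set.Ioo (0 : ℝ) 1)
    (hroot : G2 * νs ^ 2 + (G0 * G1 + G3 - G2) * νs - G3 = 0)
    (huniq : ∀ x ∈ Set.Ioo (0 : ℝ) 1,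
      G2 * x ^ 2 + (G0 * G1 + G3 - G2) * x - G3 = 0 → x = νs) :
    ∀ ν ∈ Set.Ioo (0 : ℝ) 1,
      max ((G2 + G3 / ν) / G0) (G1 / (1 - ν)) ≥ G1 / (1 - νs) ∧
      (max ((G2 + G3 / ν) / G0) (G1 / (1 - ν)) = G1 / (1 - νs) ↔ ν = νs) := by
  obtain ⟨hs0, hs1⟩ := hmem
  have crossing : (G2 + G3 / νs) / G0 = G1 / (1 - νs) := by
    have : 1 - νs ≠ 0 := by linarith
    field_simp
    linarith
  rintro ν ⟨hν0, hν1⟩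
  rcases lt_trichotomy ν νs with h | rfl | h
  · have hlt : G1 / (1 - νs) < max ((G2 + G3 / ν) / G0) (G1 / (1 - ν)) := by
      refine lt_max_of_lt_left ?_
      rw [← crossing]
      gcongr
    exact ⟨hlt.le, iff_of_false hlt.ne' h.ne⟩
  · simp [crossing]
  · have hlt : G1 / (1 - νs) < max ((G2 + G3 / ν) / G0) (G1 / (1 - ν)) :=
      lt_max_of_lt_right (div_lt_div_of_pos_left h1 (by linarith) (by linarith))
    exact ⟨hlt.le, iff_of_false hlt.ne' h.ne'⟩
end

section
/- Let Ξ ∈ (0,1], C_I ∈ (0,1) with 1 − C_I < Ξ, G0 := ln(Ξ/(1 − C_I)), let G2 > 0, G3 > 0, K > 0, C_H > 0, G1 := C_H/K, and let ν* ∈ (0,1) be the unique root in (0,1) of G2·x² + (G0·G1 + G3 − G2)·x − G3 = 0, with P* := G1/(1 − ν*). Then: (i) every pair (P, ν) with P > 0 and ν ∈ (0,1) satisfying both 1 − exp(−(G2 + G3/ν)/P)·Ξ ≤ C_I and (1 − ν)·P·K ≥ C_H has P ≥ P*; and (ii) the pair (P*, ν*) satisfies both constraints with equality: 1 − exp(−(G2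 + G3/ν*)/P*)·Ξ = C_I and (1 − ν*)·P*·K = C_H. -/
open Real

/-- Optimization II (joint optimization of power and splitting ratio): every feasible pair
`(P, ν)` has `P ≥ P* = G1/(1 - ν*)`, and at `(P*, ν*)` both the outage and harvesting
constraints are binding (hold with equality). -/
theorem joint_power_splitting_optimum
    (Ξ CI G0 G2 G3 K CH G1 νs Ps : ℝ)
    (hΞ : Ξ ∈ Set.Ioc (0 : ℝ) 1) (hCI : CI ∈ Set.Ioo (0 : ℝ) 1) (hfeas : 1 - CI < Ξ)
    (hG0 : G0 = Real.log (Ξ / (1 - CI)))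
    (hG2 : 0 < G2) (hG3 : 0 < G3) (hK : 0 < K) (hCH : 0 < CH)
    (hG1 : G1 = CH / K)
    (hmem : νs ∈ Set.Ioo (0 : ℝ) 1)
    (hroot : G2 * νs ^ 2 + (G0 * G1 + G3 - G2) * νs - G3 = 0)
    (huniq : ∀ x ∈ Set.Ioo (0 : ℝ) 1,
      G2 * x ^ 2 + (G0 * G1 + G3 - G2) * x - G3 = 0 → x = νs)
    (hPs : Ps = G1 / (1 - νs)) :
    (∀ P > (0 : ℝ), ∀ ν ∈ Set.Ioo (0 : ℝ) 1,
      1 - Real.exp (-(G2 + G3 / ν) / P) * Ξ ≤ CI → (1 - ν) * P * K ≥ CH → P ≥ Ps) ∧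
    1 - Real.exp (-(G2 + G3 / νs) / Ps) * Ξ = CI ∧
    (1 - νs) * Ps * K = CH := by
  obtain ⟨hΞ0, -⟩ := hΞ
  obtain ⟨-, hCI1⟩ := hCI
  obtain ⟨hν0, hν1⟩ := hmem
  have hc : 0 < 1 - CI := by linarith
  have h1ν : 0 < 1 - νs := by linarith
  have hG0pos : 0 < G0 := by
    rw [hG0]
    exact Real.log_pos ((one_lt_div hc).2 hfeas)
  have hG1pos : 0 < G1 := hG1 ▸ div_pos hCH hK
  have hPpos : 0 < Ps := hPs ▸ div_pos hG1pos h1ν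
  have hG1K : G1 * K = CH := by rw [hG1]; field_simp
  have hPs' : (1 - νs) * Ps = G1 := by rw [hPs]; field_simp
  have hexp : Real.exp (-G0) * Ξ = 1 - CI := by
    rw [Real.exp_neg, hG0, Real.exp_log (div_pos hΞ0 hc)]
    field_simp
  have hbind : G2 + G3 / νs = G0 * Ps := by
    rw [hPs]
    field_simp
    linarith
  refine ⟨fun P hP ν hν hout hharv => ?_, ?_, ?_⟩
  · obtain ⟨hx0, hx1⟩ := hν
    rcases le_total νs ν with h | h
    · have hle : G1 ≤ (1 - ν) * P := le_of_mul_le_mul_right (by linarith) hK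
      have hmono : (1 - ν) * P ≤ (1 - νs) * P := by gcongr
      exact le_of_mul_le_mul_left (by linarith) h1ν
    · have hle : Real.exp (-G0) ≤ Real.exp (-(G2 + G3 / ν) / P) :=
        le_of_mul_le_mul_right (by linarith) hΞ0
      rw [Real.exp_le_exp, le_div_iff₀ hP] at hle
      have hmono : G3 / νs ≤ G3 / ν := by gcongr
      exact le_of_mul_le_mul_left (by linarith) hG0pos
  · have harg : -(G2 + G3 / νs) / Ps = -G0 := by
      rw [hbind]
      field_simp
    rw [harg, hexp]
    ring
  · rw [hPs', hG1K]
end
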